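/- Let P_1 be a compactly supported Borel probability measure on ℝ and let N ≥ 1. Fix k ≥ 0, 0 = ζ_0 < ζ_1 < ⋯ < ζ_k < ζ_{k+1} = 1 and 0 = q_{-1} ≤ q_0 < q_1 < ⋯ < q_k. For a probability measure P on ℝ^d (d ≥ 1) define X_k^{(d,P)}(y_0,…,y_k) := log ∫ exp( ∑_{ℓ=0}^k (2q_ℓ − 2q_{ℓ-1})^{1/2} y_ℓ·σ − q_k|σ|² ) dP(σ) for y_0,…,y_k ∈ ℝ^d, recursively X_{ℓ-1}^{(d,P)}(y_0,…,y_{ℓ-1}) := ζ_ℓ^{-1} log E_{y_ℓ}[ exp(ζ_ℓ X_ℓ^{(d,P)}(y_0,…,y_ℓ)) ] for ℓ = k,…,1, where E_{y_ℓ} integrates y_ℓ against the standard Gaussian measure on ℝ^d, and set F^{(d,P)} := −d^{-1} E_{y_0}[ X_0^{(d,P)}(y_0) ]. Then F^{(N, P_1^{⊗N})} = F^{(1, P_1)}. -/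

import Mathlib

open MeasureTheory ProbabilityTheory

/-- Standard Gaussian measure on `ℝ^d`. -/
noncomputable def gaussD (d : ℕ) : Measure (Fin d → ℝ) :=
  Measure.pi fun _ => gaussianReal 0 1

/-- The innermost quantity
`X_k^{(d,P)}(y_0,…,y_k) = log ∫ exp(∑_ℓ (2q_ℓ - 2q_{ℓ-1})^{1/2} y_ℓ·σ - q_k|σ|²) dP(σ)`,
with the convention `q_{-1} = 0`. -/
noncomputable def Xtop (d k : ℕ) (q : ℕ → ℝ) (P : Measure (Fin d → ℝ))
    (y : ℕ → Fin d → ℝ) : ℝ :=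
  Real.log (∫ σ, Real.exp ((∑ ℓ ∈ Finset.range (k + 1),
        Real.sqrt (2 * q ℓ - 2 * (if ℓ = 0 then 0 else q (ℓ - 1))) * ∑ i, y ℓ i * σ i)
    - q k * ∑ i, σ i ^ 2) ∂P)

/-- The downward recursion `X_{ℓ-1} = ζ_ℓ⁻¹ log E_{y_ℓ} exp(ζ_ℓ X_ℓ)`, reindexed so that
`cascade j = X_{k-j}`; in particular `cascade 0 = X_k` and `cascade k = X_0`. -/
noncomputable def cascade (d k : ℕ) (ζ q : ℕ → ℝ) (P : Measure (Fin d → ℝ)) :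
    ℕ → (ℕ → Fin d → ℝ) → ℝ
  | 0 => Xtop d k q P
  | j + 1 => fun y => (ζ (k - j))⁻¹ *
      Real.log (∫ z, Real.exp (ζ (k - j) *
        cascade d k ζ q P j (Function.update y (k - j) z)) ∂(gaussD d))

/-- The free energy `F^{(d,P)} = -d⁻¹ E_{y_0}[X_0^{(d,P)}(y_0)]`. -/
noncomputable def freeEnergyD (d k : ℕ) (ζ q : ℕ → ℝ)
    (P : Measure (Fin d → ℝ)) : ℝ :=
  -(1 / (d : ℝ)) * ∫ z, cascade d k ζ q P k (fun _ => z) ∂(gaussD d)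

/-- The one-site version of `cascade`, as a function of scalar fields. -/
noncomputable def scalarCascade (k : ℕ) (ζ q : ℕ → ℝ) (P : Measure ℝ) : ℕ → (ℕ → ℝ) → ℝ
  | 0 => fun y => Real.log (∫ x, Real.exp ((∑ ℓ ∈ Finset.range (k + 1),
      Real.sqrt (2 * q ℓ - 2 * (if ℓ = 0 then 0 else q (ℓ - 1))) * (y ℓ * x)) - q k * x ^ 2) ∂P)
  | j + 1 => fun y => (ζ (k - j))⁻¹ *
      Real.log (∫ z, Real.exp (ζ (k - j) *
        scalarCascade k ζ q P j (Function.update y (k - j) z)) ∂(gaussianReal 0 1))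

/-- Lipschitz dependence on the first `n` coordinates, in the `ℓ¹` distance. -/
def LipschitzOnCoords (n : ℕ) (L : ℝ) (G : (ℕ → ℝ) → ℝ) : Prop :=
  ∀ y y' : ℕ → ℝ, G y ≤ G y' + L * ∑ ℓ ∈ Finset.range n, |y ℓ - y' ℓ|

theorem log_integral_exp_le_add {α : Type*} [MeasurableSpace α] {μ : Measure α} [NeZero μ]
    {f g : α → ℝ} {c : ℝ} (hf : Integrable (fun x => Real.exp (f x)) μ)
    (hg : Integrable (fun x => Real.exp (g x)) μ) (h : ∀ᵐ x ∂μ, f x ≤ g x + c) :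
    Real.log (∫ x, Real.exp (f x) ∂μ) ≤ Real.log (∫ x, Real.exp (g x) ∂μ) + c := by
  have hle : ∫ x, Real.exp (f x) ∂μ ≤ (∫ x, Real.exp (g x) ∂μ) * Real.exp c := by
    rw [← integral_mul_const]
    refine integral_mono_ae hf (hg.mul_const _) ?_
    filter_upwards [h] with x hx
    rw [← Real.exp_add]
    exact Real.exp_le_exp.2 hx
  calc Real.log (∫ x, Real.exp (f x) ∂μ)
      ≤ Real.log ((∫ x, Real.exp (g x) ∂μ) * Real.exp c) :=
        Real.log_le_log (integral_exp_pos hf) hle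
    _ = _ := by
        rw [Real.log_mul (integral_exp_pos hg).ne' (Real.exp_pos c).ne', Real.log_exp]

/-- Exponentials of sums over independent sites factorize, so their log-integrals add up. -/
theorem log_integral_exp_sum_pi {ι α : Type*} [Fintype ι] [MeasurableSpace α] {μ : Measure α}
    [SigmaFinite μ] [NeZero μ] {f : ι → α → ℝ}
    (hf : ∀ i, Integrable (fun x => Real.exp (f i x)) μ) :
    Real.log (∫ x, Real.exp (∑ i, f i (x i)) ∂(Measure.pi fun _ : ι => μ))
      = ∑ i, Real.log (∫ x, Real.exp (f i x) ∂μ) := by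
  simp_rw [Real.exp_sum]
  rw [integral_fintype_prod_eq_prod (fun i x => Real.exp (f i x)),
    Real.log_prod fun i _ => (integral_exp_pos (hf i)).ne']

theorem integrable_exp_gaussianReal_of_lipschitz {f : ℝ → ℝ} {L : ℝ} (hL : 0 ≤ L)
    (hf : ∀ x y, f x ≤ f y + L * |x - y|) :
    Integrable (fun z => Real.exp (f z)) (gaussianReal 0 1) := by
  have hcont : Continuous f :=
    (LipschitzWith.of_le_add_mul L.toNNReal fun x y => by
      simpa [Real.dist_eq, hL] using hf x y).continuous
  have hexp : Integrable (fun z => Real.exp (L * |z|)) (gaussianReal 0 1) :=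
    integrable_exp_mul_abs (X := id) (integrable_exp_mul_gaussianReal L)
      (integrable_exp_mul_gaussianReal (-L))
  refine (hexp.const_mul (Real.exp (f 0))).mono'
    (Real.continuous_exp.comp hcont).aestronglyMeasurable (.of_forall fun z => ?_)
  rw [Real.norm_eq_abs, Real.abs_exp, ← Real.exp_add]
  exact Real.exp_le_exp.2 (by simpa using hf z 0)

theorem integrable_gaussianReal_of_lipschitz {f : ℝ → ℝ} {L : ℝ} (hL : 0 ≤ L)
    (hf : ∀ x y, f x ≤ f y + L * |x - y|) : Integrable f (gaussianReal 0 1) := by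
  have hlip : LipschitzWith L.toNNReal f :=
    LipschitzWith.of_le_add_mul L.toNNReal fun x y => by simpa [Real.dist_eq, hL] using hf x y
  have hid : Integrable (fun z : ℝ => z) (gaussianReal 0 1) :=
    (memLp_id_gaussianReal 1).integrable le_rfl
  refine ((integrable_const |f 0|).add (hid.abs.const_mul L)).mono'
    hlip.continuous.aestronglyMeasurable (.of_forall fun z => ?_)
  have h := hlip.dist_le_mul z 0
  simp only [Real.dist_eq, sub_zero, Real.coe_toNNReal L hL] at h
  have := abs_sub_abs_le_abs_sub (f z) (f 0)
  simp only [Real.norm_eq_abs, Pi.add_apply]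
  linarith

theorem LipschitzOnCoords.update {n : ℕ} {L : ℝ} {G : (ℕ → ℝ) → ℝ} (hL : 0 ≤ L)
    (hG : LipschitzOnCoords n L G) (y : ℕ → ℝ) (m : ℕ) (x z : ℝ) :
    G (Function.update y m x) ≤ G (Function.update y m z) + L * |x - z| := by
  refine (hG _ _).trans (add_le_add_right (mul_le_mul_of_nonneg_left ?_ hL) _)
  have h : ∀ ℓ ∈ Finset.range n, |Function.update y m x ℓ - Function.update y m z ℓ|
      = if ℓ = m then |x - z| else 0 := by
    intro ℓ _
    by_cases h : ℓ = m
    · subst h; simp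
    · simp [h]
  rw [Finset.sum_congr rfl h, Finset.sum_ite_eq']
  split_ifs
  exacts [le_rfl, abs_nonneg _]

theorem LipschitzOnCoords.integrable_exp_update {n : ℕ} {L : ℝ} {G : (ℕ → ℝ) → ℝ} (hL : 0 ≤ L)
    (hG : LipschitzOnCoords n L G) {a : ℝ} (ha : 0 ≤ a) (y : ℕ → ℝ) (m : ℕ) :
    Integrable (fun z => Real.exp (a * G (Function.update y m z))) (gaussianReal 0 1) := by
  refine integrable_exp_gaussianReal_of_lipschitz (mul_nonneg ha hL) fun x z => ?_
  have := mul_le_mul_of_nonneg_left (hG.update hL y m x z) ha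
  linarith

/-- One step of the cascade recursion preserves Lipschitz constants. -/
theorem LipschitzOnCoords.log_integral {n : ℕ} {L : ℝ} {G : (ℕ → ℝ) → ℝ} (hL : 0 ≤ L)
    (hG : LipschitzOnCoords n L G) {a : ℝ} (ha : 0 < a) (m : ℕ) :
    LipschitzOnCoords n L fun y => a⁻¹ *
      Real.log (∫ z, Real.exp (a * G (Function.update y m z)) ∂(gaussianReal 0 1)) := by
  intro y y'
  have hstep : ∀ z, a * G (Function.update y m z) ≤ a * G (Function.update y' m z)
      + a * (L * ∑ ℓ ∈ Finset.range n, |y ℓ - y' ℓ|) := by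
    intro z
    rw [← mul_add]
    refine mul_le_mul_of_nonneg_left ((hG _ _).trans (add_le_add_right
      (mul_le_mul_of_nonneg_left (Finset.sum_le_sum fun ℓ _ => ?_) hL) _)) ha.le
    by_cases h : ℓ = m
    · subst h; simp
    · simp [h]
  have := mul_le_mul_of_nonneg_left (log_integral_exp_le_add
    (hG.integrable_exp_update hL ha.le y m) (hG.integrable_exp_update hL ha.le y' m)
    (.of_forall hstep)) (inv_nonneg.2 ha.le)
  rwa [mul_add, inv_mul_cancel_left₀ ha.ne'] at this

theorem integrable_exp_of_ae_abs_le {P : Measure ℝ} [IsFiniteMeasure P] {C : ℝ}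
    (hC : ∀ᵐ x ∂P, |x| ≤ C) {f : ℝ → ℝ} (hf : Continuous f) :
    Integrable (fun x => Real.exp (f x)) P := by
  have hcont : Continuous fun x => Real.exp (f x) := Real.continuous_exp.comp hf
  obtain ⟨B, hB⟩ := (isCompact_Icc (a := -C) (b := C)).exists_bound_of_continuousOn
    hcont.continuousOn
  refine Integrable.of_bound hcont.aestronglyMeasurable B ?_
  filter_upwards [hC] with x hx
  exact hB x (abs_le.1 hx)

theorem exists_lipschitzOnCoords_scalarCascade {k : ℕ} {ζ : ℕ → ℝ}
    (hζ : ∀ m, 1 ≤ m → m ≤ k → 0 < ζ m) (q : ℕ → ℝ) {P : Measure ℝ} [IsProbabilityMeasure P]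
    {C : ℝ} (hC : ∀ᵐ x ∂P, |x| ≤ C) :
    ∃ L, 0 ≤ L ∧ ∀ j ≤ k, LipschitzOnCoords (k + 1) L (scalarCascade k ζ q P j) := by
  set c : ℕ → ℝ := fun ℓ => Real.sqrt (2 * q ℓ - 2 * (if ℓ = 0 then 0 else q (ℓ - 1))) with hc
  have hc0 : ∀ ℓ, 0 ≤ c ℓ := fun ℓ => Real.sqrt_nonneg _
  have hS : 0 ≤ ∑ ℓ ∈ Finset.range (k + 1), c ℓ := Finset.sum_nonneg fun ℓ _ => hc0 ℓ
  have hC0 : 0 ≤ C := by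
    obtain ⟨x, hx⟩ := hC.exists
    exact (abs_nonneg x).trans hx
  have hL : 0 ≤ (∑ ℓ ∈ Finset.range (k + 1), c ℓ) * C := mul_nonneg hS hC0
  refine ⟨_, hL, fun j => ?_⟩
  induction j with
  | zero =>
    intro _ y y'
    simp only [scalarCascade]
    refine log_integral_exp_le_add (integrable_exp_of_ae_abs_le hC (by fun_prop))
      (integrable_exp_of_ae_abs_le hC (by fun_prop)) ?_
    filter_upwards [hC] with x hx
    have hterm : ∀ ℓ ∈ Finset.range (k + 1), c ℓ * (y ℓ * x) - c ℓ * (y' ℓ * x)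
        ≤ ((∑ ℓ ∈ Finset.range (k + 1), c ℓ) * C) * |y ℓ - y' ℓ| := by
      intro ℓ hℓ
      have h1 : (y ℓ - y' ℓ) * x ≤ C * |y ℓ - y' ℓ| := by
        rw [mul_comm C]
        refine (le_abs_self _).trans ?_
        rw [abs_mul]
        exact mul_le_mul_of_nonneg_left hx (abs_nonneg _)
      calc c ℓ * (y ℓ * x) - c ℓ * (y' ℓ * x) = c ℓ * ((y ℓ - y' ℓ) * x) := by ring
        _ ≤ c ℓ * (C * |y ℓ - y' ℓ|) := mul_le_mul_of_nonneg_left h1 (hc0 ℓ)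
        _ ≤ (∑ ℓ ∈ Finset.range (k + 1), c ℓ) * (C * |y ℓ - y' ℓ|) :=
            mul_le_mul_of_nonneg_right (Finset.single_le_sum (fun i _ => hc0 i) hℓ)
              (mul_nonneg hC0 (abs_nonneg _))
        _ = _ := by ring
    have hsum := Finset.sum_le_sum hterm
    rw [Finset.sum_sub_distrib, ← Finset.mul_sum] at hsum
    simp only [hc] at hsum ⊢
    linarith
  | succ j ih =>
    intro hj
    exact (ih (by omega)).log_integral hL (hζ (k - j) (by omega) (by omega)) (k - j)

/-- For product reference measures the cascade decouples over the sites. -/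
theorem cascade_pi_eq_sum (d : ℕ) {k : ℕ} {ζ : ℕ → ℝ}
    (hζ : ∀ m, 1 ≤ m → m ≤ k → 0 < ζ m) (q : ℕ → ℝ) {P : Measure ℝ} [IsProbabilityMeasure P]
    {C : ℝ} (hC : ∀ᵐ x ∂P, |x| ≤ C) {j : ℕ} (hj : j ≤ k) (y : ℕ → Fin d → ℝ) :
    cascade d k ζ q (Measure.pi fun _ => P) j y
      = ∑ i, scalarCascade k ζ q P j (fun ℓ => y ℓ i) := by
  obtain ⟨L, hL, hLip⟩ := exists_lipschitzOnCoords_scalarCascade hζ q hC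
  induction j generalizing y with
  | zero =>
    simp only [cascade, Xtop, scalarCascade]
    rw [← log_integral_exp_sum_pi fun i => integrable_exp_of_ae_abs_le hC (by fun_prop)]
    congr 2
    ext σ
    rw [Finset.sum_sub_distrib, ← Finset.mul_sum, Finset.sum_comm]
    simp_rw [Finset.mul_sum]
  | succ j ih =>
    have hupd : ∀ (z : Fin d → ℝ) (i : Fin d), (fun ℓ => Function.update y (k - j) z ℓ i)
        = Function.update (fun ℓ => y ℓ i) (k - j) (z i) := by
      intro z i
      ext ℓ
      by_cases h : ℓ = k - j
      · subst h; simp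
      · simp [h]
    simp only [cascade, scalarCascade, gaussD]
    simp_rw [ih (by omega), hupd, Finset.mul_sum]
    rw [log_integral_exp_sum_pi fun i => (hLip j (by omega)).integrable_exp_update hL
      (hζ (k - j) (by omega) (by omega)).le (fun ℓ => y ℓ i) (k - j), Finset.mul_sum]

theorem freeEnergyD_pi {d : ℕ} (hd : 1 ≤ d) {k : ℕ} {ζ : ℕ → ℝ}
    (hζ : ∀ m, 1 ≤ m → m ≤ k → 0 < ζ m) (q : ℕ → ℝ) {P : Measure ℝ} [IsProbabilityMeasure P]
    {C : ℝ} (hC : ∀ᵐ x ∂P, |x| ≤ C) :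
    freeEnergyD d k ζ q (Measure.pi fun _ => P)
      = -∫ z, scalarCascade k ζ q P k (fun _ => z) ∂(gaussianReal 0 1) := by
  obtain ⟨L, hL, hLip⟩ := exists_lipschitzOnCoords_scalarCascade hζ q hC
  have hInt : Integrable (fun z => scalarCascade k ζ q P k (fun _ => z)) (gaussianReal 0 1) := by
    refine integrable_gaussianReal_of_lipschitz (L := L * (k + 1)) (by positivity) fun x y => ?_
    simpa [mul_assoc] using hLip k le_rfl (fun _ => x) (fun _ => y)
  have hmp : ∀ i : Fin d, MeasurePreserving (fun z : Fin d → ℝ => z i) (gaussD d)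
      (gaussianReal 0 1) := fun i =>
    measurePreserving_eval (fun _ : Fin d => gaussianReal 0 1) i
  have hd0 : (d : ℝ) ≠ 0 := by positivity
  simp only [freeEnergyD, cascade_pi_eq_sum d hζ q hC le_rfl]
  have hInt' : ∀ i : Fin d, Integrable (fun z : Fin d → ℝ =>
      scalarCascade k ζ q P k (fun _ => z i)) (gaussD d) := fun i =>
    (hmp i).integrable_comp_of_integrable hInt
  rw [integral_finsetSum _ fun i _ => hInt' i]
  have heval : ∀ i : Fin d, ∫ z, scalarCascade k ζ q P k (fun _ => z i) ∂(gaussD d)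
      = ∫ z, scalarCascade k ζ q P k (fun _ => z) ∂(gaussianReal 0 1) := by
    intro i
    rw [← (hmp i).map_eq, integral_map (hmp i).measurable.aemeasurable]
    rw [(hmp i).map_eq]
    exact hInt.aestronglyMeasurable
  simp only [heval, Finset.sum_const, Finset.card_univ, Fintype.card_fin, nsmul_eq_mul]
  field_simp

/-- Proposition 3.1(1) of the paper: for a compactly supported probability measure `P₁`
on `ℝ` and a product reference measure `P₁^{⊗N}`, the cascade free energy at `t = 0`
is independent of `N`: `F^{(N, P₁^{⊗N})} = F^{(1, P₁)}`. -/
theorem freeEnergyD_product (P₁ : Measure ℝ) [IsProbabilityMeasure P₁]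
    (hP₁ : ∃ C : ℝ, P₁ {x : ℝ | |x| ≤ C} = 1)
    (N : ℕ) (hN : 1 ≤ N) (k : ℕ)
    (ζ : ℕ → ℝ) (hζ0 : ζ 0 = 0) (hζtop : ζ (k + 1) = 1)
    (hζ : ∀ ℓ ≤ k, ζ ℓ < ζ (ℓ + 1))
    (q : ℕ → ℝ) (hq0 : 0 ≤ q 0) (hq : ∀ ℓ < k, q ℓ < q (ℓ + 1)) :
    freeEnergyD N k ζ q (Measure.pi fun _ : Fin N => P₁)
      = freeEnergyD 1 k ζ q (P₁.map fun x (_ : Fin 1) => x) := by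
  have hpos : ∀ m, 1 ≤ m → m ≤ k → 0 < ζ m := by
    intro m hm
    induction m, hm using Nat.le_induction with
    | base => exact fun _ => hζ0 ▸ hζ 0 (Nat.zero_le k)
    | succ m _ ih => exact fun h => (ih (by omega)).trans (hζ m (by omega))
  obtain ⟨C, hC⟩ := hP₁
  have hC' : ∀ᵐ x ∂P₁, |x| ≤ C :=
    (mem_ae_iff_prob_eq_one (measurableSet_le measurable_norm measurable_const)).2 hC
  have hmap : P₁.map (fun x (_ : Fin 1) => x) = Measure.pi fun _ : Fin 1 => P₁ :=
    (measurePreserving_funUnique P₁ (Fin 1)).symm.map_eq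
  rw [hmap, freeEnergyD_pi hN hpos q hC', freeEnergyD_pi le_rfl hpos q hC']
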